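/- arXiv:2407.03957 — 2 statements merged into one kernel-verified Lean document; each statement's English description precedes it below -/
import Mathlib

section
/- Let M ∈ 𝔽^{m×p} and r ∈ 𝔽^m with r ∈ range(M). Then lim_{ε → 0⁺} r*(M M* + ε I)^{-1} r = ‖M† r‖². -/
open Matrix

/-- If `D` is the Moore–Penrose inverse of `M` and `G = Dᴴ D`, then `(M Mᴴ + c) G = M D (1 + c G)`. -/
theorem gram_add_smul_mul_pinv_gram {R m p : Type*} [CommRing R] [StarRing R]
    [Fintype m] [Fintype p] [DecidableEq m]
    {M : Matrix m p R} {D : Matrix p m R}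
    (h1 : M * D * M = M) (h2 : D * M * D = D)
    (h3 : (M * D)ᴴ = M * D) (h4 : (D * M)ᴴ = D * M) (c : R) :
    (M * Mᴴ + c • (1 : Matrix m m R)) * (Dᴴ * D) = M * D * (1 + c • (Dᴴ * D)) := by
  have hgram : M * Mᴴ * (Dᴴ * D) = M * D := by
    calc M * Mᴴ * (Dᴴ * D) = M * (D * M)ᴴ * D := by
          simp only [conjTranspose_mul, Matrix.mul_assoc]
      _ = M * D * M * D := by rw [h4]; simp only [Matrix.mul_assoc]
      _ = M * D := by rw [h1]
  have hproj : M * D * (Dᴴ * D) = Dᴴ * D := by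
    calc M * D * (Dᴴ * D) = (D * (M * D))ᴴ * D := by
          rw [conjTranspose_mul D (M * D), h3]; simp only [Matrix.mul_assoc]
      _ = Dᴴ * D := by rw [← Matrix.mul_assoc, h2]
  rw [Matrix.add_mul, hgram, Matrix.mul_add, Matrix.mul_one, Matrix.mul_smul, hproj,
    Matrix.smul_mul, Matrix.one_mul]

open scoped ComplexOrder in
theorem isUnit_det_mul_conjTranspose_add_smul_one {𝕜 m p : Type*} [RCLike 𝕜]
    [Fintype m] [Fintype p] [DecidableEq m] (M : Matrix m p 𝕜) {ε : ℝ} (hε : 0 < ε) :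
    IsUnit (M * Mᴴ + (ε : 𝕜) • (1 : Matrix m m 𝕜)).det :=
  (isUnit_iff_isUnit_det _).mp <| PosDef.isUnit <|
    PosDef.posSemidef_add (posSemidef_self_mul_conjTranspose M)
      (PosDef.one.smul (RCLike.ofReal_pos.mpr hε))

theorem re_star_dotProduct_gram_mulVec {𝕜 m p : Type*} [RCLike 𝕜]
    [Fintype m] [Fintype p] (D : Matrix p m 𝕜) (r : m → 𝕜) :
    RCLike.re (star r ⬝ᵥ (Dᴴ * D) *ᵥ r) = ∑ i, ‖(D *ᵥ r) i‖ ^ 2 := by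
  rw [← mulVec_mulVec, dotProduct_mulVec, ← star_mulVec, dotProduct, map_sum]
  refine Finset.sum_congr rfl fun i _ => ?_
  rw [Pi.star_apply, RCLike.star_def, RCLike.conj_mul]
  norm_cast

/-- If `r ∈ range M`, then `r*(MM*+εI)⁻¹r → ‖M† r‖²` as `ε → 0⁺`. -/
theorem stmt_5 {𝕜 : Type*} [RCLike 𝕜] {m p : ℕ}
    (M : Matrix (Fin m) (Fin p) 𝕜) (Mdag : Matrix (Fin p) (Fin m) 𝕜)
    (h1 : M * Mdag * M = M) (h2 : Mdag * M * Mdag = Mdag)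
    (h3 : (M * Mdag)ᴴ = M * Mdag) (h4 : (Mdag * M)ᴴ = Mdag * M)
    (r : Fin m → 𝕜) (hr : ∃ δ : Fin p → 𝕜, M.mulVec δ = r) :
    Filter.Tendsto
      (fun ε : ℝ =>
        RCLike.re (star r ⬝ᵥ ((M * Mᴴ + (ε : 𝕜) • (1 : Matrix (Fin m) (Fin m) 𝕜))⁻¹).mulVec r))
      (nhdsWithin 0 (Set.Ioi 0))
      (nhds (∑ i, ‖Mdag.mulVec r i‖ ^ 2)) := by
  set G := Mdagᴴ * Mdag with hG
  have hr' : (M * Mdag) *ᵥ r = r := by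
    obtain ⟨δ, rfl⟩ := hr
    rw [mulVec_mulVec, h1]
  have hT : ContinuousAt (fun ε : ℝ => 1 + (ε : 𝕜) • G) 0 := by
    have : Continuous (fun ε : ℝ => (ε : 𝕜)) := RCLike.continuous_ofReal
    fun_prop
  have hdet0 : (1 + ((0 : ℝ) : 𝕜) • G).det ≠ 0 := by simp
  have hinv : ContinuousAt (fun ε : ℝ => (1 + (ε : 𝕜) • G)⁻¹) 0 :=
    ContinuousAt.comp (f := fun ε : ℝ => 1 + (ε : 𝕜) • G) (continuousAt_matrix_inv _ <| by
      rw [Ring.inverse_eq_inv']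
      exact continuousAt_inv₀ hdet0) hT
  have hdet : ∀ᶠ ε : ℝ in nhds 0, (1 + (ε : 𝕜) • G).det ≠ 0 :=
    (continuous_id.matrix_det.continuousAt.comp hT).eventually_ne hdet0
  have hlim : ContinuousAt
      (fun ε : ℝ => RCLike.re (star r ⬝ᵥ (G * (1 + (ε : 𝕜) • G)⁻¹) *ᵥ r)) 0 := by
    have hcont : Continuous fun B : Matrix (Fin m) (Fin m) 𝕜 =>
        RCLike.re (star r ⬝ᵥ (G * B) *ᵥ r) :=
      RCLike.continuous_re.comp (continuous_const.dotProduct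
        ((continuous_const.matrix_mul continuous_id).matrix_mulVec continuous_const))
    exact hcont.continuousAt.comp hinv
  have hval : RCLike.re (star r ⬝ᵥ (G * (1 + ((0 : ℝ) : 𝕜) • G)⁻¹) *ᵥ r)
      = ∑ i, ‖Mdag.mulVec r i‖ ^ 2 := by
    rw [RCLike.ofReal_zero, zero_smul, add_zero, inv_one, Matrix.mul_one]
    exact re_star_dotProduct_gram_mulVec Mdag r
  rw [← hval]
  refine (hlim.tendsto.mono_left nhdsWithin_le_nhds).congr' ?_
  filter_upwards [hdet.filter_mono nhdsWithin_le_nhds, self_mem_nhdsWithin] with ε hε hpos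
  have hA := isUnit_det_mul_conjTranspose_add_smul_one (𝕜 := 𝕜) M hpos
  have hsolve : (M * Mᴴ + (ε : 𝕜) • (1 : Matrix (Fin m) (Fin m) 𝕜)) *ᵥ
      ((G * (1 + (ε : 𝕜) • G)⁻¹) *ᵥ r) = r := by
    rw [mulVec_mulVec, ← Matrix.mul_assoc, gram_add_smul_mul_pinv_gram h1 h2 h3 h4,
      mul_nonsing_inv_cancel_right _ _ hε.isUnit, hr']
  have hinv_mulVec := congrArg
    ((M * Mᴴ + (ε : 𝕜) • (1 : Matrix (Fin m) (Fin m) 𝕜))⁻¹ *ᵥ ·) hsolve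
  simp only [mulVec_mulVec, nonsing_inv_mul_cancel_left _ _ hA] at hinv_mulVec
  rw [hinv_mulVec]
end

section
/- Let M ∈ 𝔽^{m×p} and r ∈ 𝔽^m with r ∉ range(M). Then r*(M M* + ε I)^{-1} r → +∞ as ε → 0⁺. More precisely, writing r = M a + b with b the orthogonal projection of r onto the orthogonal complement of range(M) (so b ≠ 0), one has r*(M M* + ε I)^{-1} r ≥ ε^{-1} ‖b‖² for all ε > 0. -/
open Matrix

namespace Matrix

open scoped ComplexOrder

variable {𝕜 m p : Type*} [RCLike 𝕜] [Fintype m] [Fintype p]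

lemma re_star_dotProduct_self (b : m → 𝕜) :
    RCLike.re (star b ⬝ᵥ b) = ∑ i, ‖b i‖ ^ 2 := by
  simp only [dotProduct, Pi.star_apply, RCLike.star_def, RCLike.conj_mul, ← RCLike.ofReal_pow,
    map_sum, RCLike.ofReal_re]

variable [DecidableEq m]

lemma posDef_mul_conjTranspose_self_add_smul_one (M : Matrix m p 𝕜) {ε : ℝ} (hε : 0 < ε) :
    (M * Mᴴ + (ε : 𝕜) • (1 : Matrix m m 𝕜)).PosDef :=
  (PosDef.one.smul (RCLike.ofReal_pos.mpr hε)).posSemidef_add (posSemidef_self_mul_conjTranspose M)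

lemma inv_mul_conjTranspose_self_add_smul_one_mulVec (M : Matrix m p 𝕜) {b : m → 𝕜}
    (hb : Mᴴ *ᵥ b = 0) {ε : ℝ} (hε : 0 < ε) :
    (M * Mᴴ + (ε : 𝕜) • (1 : Matrix m m 𝕜))⁻¹ *ᵥ b = (ε : 𝕜)⁻¹ • b := by
  have hdet := (isUnit_iff_isUnit_det _).mp
    (posDef_mul_conjTranspose_self_add_smul_one M hε).isUnit
  have hε' : (ε : 𝕜) ≠ 0 := RCLike.ofReal_ne_zero.mpr hε.ne'
  set S := M * Mᴴ + (ε : 𝕜) • (1 : Matrix m m 𝕜) with hS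
  have hSb : S *ᵥ ((ε : 𝕜)⁻¹ • b) = b := by
    rw [mulVec_smul, hS, add_mulVec, ← mulVec_mulVec, hb, mulVec_zero, zero_add, smul_mulVec,
      one_mulVec, inv_smul_smul₀ hε']
  conv_lhs => rw [← hSb]
  rw [mulVec_mulVec, nonsing_inv_mul _ hdet, one_mulVec]

theorem inv_mul_sum_norm_sq_le_re_dotProduct_inv_mulVec (M : Matrix m p 𝕜) (a : p → 𝕜)
    {b : m → 𝕜} (hb : Mᴴ *ᵥ b = 0) {ε : ℝ} (hε : 0 < ε) :
    ε⁻¹ * ∑ i, ‖b i‖ ^ 2 ≤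
      RCLike.re (star (M *ᵥ a + b) ⬝ᵥ
        ((M * Mᴴ + (ε : 𝕜) • (1 : Matrix m m 𝕜))⁻¹ *ᵥ (M *ᵥ a + b))) := by
  have hpos := (posDef_mul_conjTranspose_self_add_smul_one M hε).inv
  have hinv := inv_mul_conjTranspose_self_add_smul_one_mulVec M hb hε
  set T := (M * Mᴴ + (ε : 𝕜) • (1 : Matrix m m 𝕜))⁻¹
  have hab : star (M *ᵥ a) ⬝ᵥ b = 0 := by
    rw [star_mulVec, ← dotProduct_mulVec, hb, dotProduct_zero]
  have hba : star b ⬝ᵥ (M *ᵥ a) = 0 := by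
    rw [star_dotProduct, hab, star_zero]
  have hcross : star b ⬝ᵥ (T *ᵥ (M *ᵥ a)) = 0 := by
    have hvec : star b ᵥ* T = star ((ε : 𝕜)⁻¹ • b) := by
      rw [← hinv, star_mulVec, hpos.isHermitian.eq]
    rw [dotProduct_mulVec, hvec, star_smul, smul_dotProduct, hba, smul_zero]
  have hnonneg : 0 ≤ RCLike.re (star (M *ᵥ a) ⬝ᵥ (T *ᵥ (M *ᵥ a))) :=
    hpos.posSemidef.re_dotProduct_nonneg _
  rw [mulVec_add, hinv, star_add, add_dotProduct, dotProduct_add, dotProduct_add, hcross,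
    dotProduct_smul, dotProduct_smul, hab, smul_zero, add_zero, zero_add, map_add, smul_eq_mul,
    ← RCLike.ofReal_inv, RCLike.re_ofReal_mul, re_star_dotProduct_self]
  exact le_add_of_nonneg_left hnonneg

end Matrix

/-- If `r ∉ range M`, writing `r = Ma + b` with `b ≠ 0` orthogonal to `range M`,
then `r*(MM*+εI)⁻¹r ≥ ε⁻¹‖b‖²` for all `ε > 0`, and in particular it tends to
`+∞` as `ε → 0⁺`. -/
theorem stmt_6 {𝕜 : Type*} [RCLike 𝕜] {m p : ℕ}
    (M : Matrix (Fin m) (Fin p) 𝕜) (r : Fin m → 𝕜)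
    (hr : ¬ ∃ δ : Fin p → 𝕜, M.mulVec δ = r)
    (a : Fin p → 𝕜) (b : Fin m → 𝕜) (hab : r = M.mulVec a + b)
    (hborth : Mᴴ.mulVec b = 0) (hb : b ≠ 0) :
    (∀ ε : ℝ, 0 < ε →
      ε⁻¹ * ∑ i, ‖b i‖ ^ 2 ≤
        RCLike.re (star r ⬝ᵥ ((M * Mᴴ + (ε : 𝕜) • (1 : Matrix (Fin m) (Fin m) 𝕜))⁻¹).mulVec r)) ∧
    Filter.Tendsto
      (fun ε : ℝ =>
        RCLike.re (star r ⬝ᵥ ((M * Mᴴ + (ε : 𝕜) • (1 : Matrix (Fin m) (Fin m) 𝕜))⁻¹).mulVec r))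
      (nhdsWithin 0 (Set.Ioi 0)) Filter.atTop := by
  subst hab
  have hbound := fun (ε : ℝ) (hε : 0 < ε) =>
    inv_mul_sum_norm_sq_le_re_dotProduct_inv_mulVec M a hborth hε
  refine ⟨hbound, Filter.tendsto_atTop_mono' _ ?_
    (tendsto_inv_nhdsGT_zero.atTop_mul_const (r := ∑ i, ‖b i‖ ^ 2) ?_)⟩
  · filter_upwards [self_mem_nhdsWithin] with ε hε using hbound ε hε
  · obtain ⟨i, hi⟩ := Function.ne_iff.mp hb
    exact Finset.sum_pos' (fun _ _ => by positivity)
      ⟨i, Finset.mem_univ i, pow_pos (norm_pos_iff.mpr hi) 2⟩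
end
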